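/- (Algebraic factorization theorem.) Let X = A ∪ B ∪ {1} with A, B, {1} pairwise disjoint and A, B nonempty, and let S, S' be opposite precells relative to X. Then Fac(U_S) = U_{(S‖1,A)} ⊗ U_{(S‖1,B)} in A(A∪{1}) ⊗ A(B∪{1}). -/

import Mathlib

open scoped Classical

namespace GRF

variable {α : Type*} [DecidableEq α]

/-- `J` is a proper (nonempty, not everything) subset of `X`. -/
def IsProperSubset (X J : Finset α) : Prop := J ⊆ X ∧ J ≠ ∅ ∧ J ≠ X

/-- A proper sequence in `P(X)`: a nonempty list of pairwise disjoint nonempty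
subsets of `X` with union `X`. -/
def IsProperSeq (X : Finset α) (c : List (Finset α)) : Prop :=
  c ≠ [] ∧ (∀ J ∈ c, J ≠ ∅) ∧ List.Pairwise (fun I J => I ∩ J = ∅) c ∧
    c.foldr (· ∪ ·) ∅ = X

/-- The product of two sequences: all `A_i ∩ B_j`, ordered first by `j` then by `i`,
with empty intersections deleted. -/
noncomputable def seqMul (a b : List (Finset α)) : List (Finset α) :=
  ((b.map fun B => a.map fun A => A ∩ B).flatten).filter fun J => J ≠ ∅

/-- The set `S' = {J ⊆ X : X \ J ∈ S}` opposite to `S`. -/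
def opp (X : Finset α) (S : Set (Finset α)) : Set (Finset α) :=
  {J | J ⊆ X ∧ X \ J ∈ S}

/-- A paracell associated to `X`. -/
def IsParacell (X : Finset α) (S : Set (Finset α)) : Prop :=
  S.Nonempty ∧ (∀ J ∈ S, IsProperSubset X J) ∧
    ∀ I ∈ S, ∀ J ∈ S, I ∩ J ∈ S ∨ I ∪ J ∈ S

/-- A precell associated to `X`. -/
def IsPrecell (X : Finset α) (S : Set (Finset α)) : Prop :=
  IsParacell X S ∧ ∀ J : Finset α, IsProperSubset X J → J ∈ S ∨ X \ J ∈ S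

/-- A cell associated to `X`: a precell admitting real weights with zero total sum,
positive on all members of the cell. -/
def IsCell (X : Finset α) (S : Set (Finset α)) : Prop :=
  IsPrecell X S ∧ ∃ s : α → ℝ,
    (∑ j ∈ X, s j) = 0 ∧ ∀ J ∈ S, 0 < ∑ j ∈ J, s j

/-- `Y ↓ S` for `S` a paracell associated to `X`. -/
def cellDown (Y X : Finset α) (S : Set (Finset α)) : Set (Finset α) :=
  {J | IsProperSubset (Y ∪ X) J ∧ (J ∩ X = X ∨ J ∩ X ∈ S)}

/-- `Y ↑ S'` for `S'` a paracell associated to `X`. -/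
def cellUp (Y X : Finset α) (S : Set (Finset α)) : Set (Finset α) :=
  {J | IsProperSubset (Y ∪ X) J ∧ (J ∩ X = ∅ ∨ J ∩ X ∈ S)}

/-- `Y ↓ j` for a single index `j`. -/
def ptDown (Y : Finset α) (j : α) : Set (Finset α) :=
  {J | IsProperSubset (insert j Y) J ∧ j ∈ J}

/-- `Y ↑ j` for a single index `j`. -/
def ptUp (Y : Finset α) (j : α) : Set (Finset α) :=
  {J | IsProperSubset (insert j Y) J ∧ j ∉ J}

/-- The underlying vector space of the algebra `A(X)`: formal complex linear
combinations of sequences of subsets. -/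
abbrev AX (α : Type*) [DecidableEq α] : Type _ := (List (Finset α)) →₀ ℂ

/-- The multiplication of `A(X)`, extending `seqMul` bilinearly. -/
noncomputable def amul (x y : AX α) : AX α :=
  x.sum fun a ca => y.sum fun b cb => Finsupp.single (seqMul a b) (ca * cb)

/-- The unit `{X}` of `A(X)`. -/
noncomputable def oneA (X : Finset α) : AX α := Finsupp.single [X] 1

/-- `Î = {I, X \ I}` as an element of `A(X)`. -/
noncomputable def hatI (X I : Finset α) : AX α := Finsupp.single [I, X \ I] 1

/-- Product of a list of elements of `A(X)` (with unit `{X}`). -/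
noncomputable def aprod (X : Finset α) (l : List (AX α)) : AX α :=
  l.foldr amul (oneA X)

/-- A `ν`-chain associated to `S'`: a proper sequence all of whose proper initial
partial unions lie in `S'`. -/
def IsChainFor (X : Finset α) (S' : Set (Finset α)) (c : List (Finset α)) : Prop :=
  IsProperSeq X c ∧
    ∀ r : ℕ, 0 < r → r < c.length → ((c.take r).foldr (· ∪ ·) ∅) ∈ S'

lemma IsProperSeq.nodup {X : Finset α} {c : List (Finset α)}
    (h : IsProperSeq X c) : c.Nodup := by
  obtain ⟨-, hne, hpw, -⟩ := h
  refine List.Pairwise.imp_of_mem ?_ hpw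
  intro a b ha _ hab
  intro h'
  subst h'
  exact hne a ha (by simpa using hab)

/-- `U_S = Σ_ν Σ_{ν-chains for S'} (−1)^{ν−1} {J_1,…,J_ν}`, as a function of the
opposite paracell `S'`. -/
noncomputable def US [Fintype α] (X : Finset α) (S' : Set (Finset α)) : AX α :=
  Finsupp.ofSupportFinite
    (fun c => if IsChainFor X S' c then (-1 : ℂ) ^ (c.length - 1) else 0)
    (Set.Finite.subset
      (List.finite_length_le (Finset α) (Fintype.card (Finset α)))
      (by
        intro c hc
        have h : IsChainFor X S' c := by
          by_contra h
          simp [Function.mem_support, h] at hc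
        exact h.1.nodup.length_le_card))

/-- The underlying vector space of `A(A∪{1}) ⊗ A(B∪{1})`. -/
abbrev AX2 (α : Type*) [DecidableEq α] : Type _ :=
  (List (Finset α) × List (Finset α)) →₀ ℂ

/-- The multiplication of the tensor product algebra. -/
noncomputable def tmul (x y : AX2 α) : AX2 α :=
  x.sum fun a ca => y.sum fun b cb =>
    Finsupp.single (seqMul a.1 b.1, seqMul a.2 b.2) (ca * cb)

/-- The tensor `u ⊗ v` of two elements of `A(A∪{1})` and `A(B∪{1})`. -/
noncomputable def tens (u v : AX α) : AX2 α :=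
  u.sum fun a ca => v.sum fun b cb => Finsupp.single (a, b) (ca * cb)

/-- The pair `(c_A, c_B)` of traces of a sequence `c` on `A∪{1}` and `B∪{1}`,
with empty sets deleted. -/
noncomputable def facSeq (A1 B1 : Finset α) (c : List (Finset α)) :
    List (Finset α) × List (Finset α) :=
  ((c.map fun J => J ∩ A1).filter fun J => J ≠ ∅,
   (c.map fun J => J ∩ B1).filter fun J => J ≠ ∅)

/-- The factorization map `Fac : A(X) → A(A∪{1}) ⊗ A(B∪{1})`. -/
noncomputable def Fac (A1 B1 : Finset α) (x : AX α) : AX2 α :=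
  x.sum fun c cc => Finsupp.single (facSeq A1 B1 c) cc

/-- The paracell `(S‖1,A)` built from opposite paracells `S`, `S'` relative to
`X = A ∪ B ∪ {o}`. -/
def restCell (A : Finset α) (o : α) (S S' : Set (Finset α)) : Set (Finset α) :=
  {J | IsProperSubset (insert o A) J ∧
    ((J ⊆ A ∧ J ∈ S) ∨ (o ∈ J ∧ A \ J ∈ S'))}



/-- union of a list -/
def UU {α : Type*} [DecidableEq α] (l : List (Finset α)) : Finset α := l.foldr (· ∪ ·) ∅

lemma mem_UU {α : Type*} [DecidableEq α] (l : List (Finset α)) (z : α) :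
    z ∈ UU l ↔ ∃ J ∈ l, z ∈ J := by
  induction l with
  | nil => simp [UU]
  | cons x l ih =>
    have : UU (x :: l) = x ∪ UU l := rfl
    simp [this, ih]

lemma UU_cons {α : Type*} [DecidableEq α] (x : Finset α) (l : List (Finset α)) :
    UU (x :: l) = x ∪ UU l := rfl

/-- every nonempty suffix has union in `T` -/
def Good {α : Type*} [DecidableEq α] (T : Set (Finset α)) : List (Finset α) → Prop
  | [] => True
  | x :: l => UU (x :: l) ∈ T ∧ Good T l

lemma good_iff {α : Type*} [DecidableEq α] (T : Set (Finset α)) (l : List (Finset α)) :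
    Good T l ↔ ∀ k, k < l.length → UU (l.drop k) ∈ T := by
  induction l with
  | nil => simp [Good]
  | cons x l ih =>
    simp only [Good, ih]
    constructor
    · rintro ⟨h1, h2⟩ k hk
      cases k with
      | zero => simpa using h1
      | succ k => simpa using h2 k (by simpa using hk)
    · intro h
      exact ⟨by simpa using h 0 (by simp), fun k hk => by simpa using h (k+1) (by simpa using hk)⟩

noncomputable def wt {α : Type*} [DecidableEq α] (T : Set (Finset α)) (c : List (Finset α)) : ℂ :=
  if Good T c then (-1) ^ c.length else 0

lemma wt_nil {α : Type*} [DecidableEq α] (T : Set (Finset α)) : wt T [] = 1 := by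
  simp [wt, Good]

lemma wt_cons {α : Type*} [DecidableEq α] (T : Set (Finset α)) (x : Finset α)
    (c : List (Finset α)) :
    wt T (x :: c) = if UU (x :: c) ∈ T then - wt T c else 0 := by
  by_cases h1 : UU (x :: c) ∈ T <;> by_cases h2 : Good T c <;> simp [wt, Good, h1, h2, pow_succ]

/-- all merges of two sequences -/
def MM {α : Type*} [DecidableEq α] : List (Finset α) → List (Finset α) → List (List (Finset α))
  | [], b => [b]
  | x :: a, [] => [x :: a]
  | x :: a, y :: b =>
    (MM a (y :: b)).map (fun c => x :: c) ++ ((MM (x :: a) b).map (fun c => y :: c) ++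
      (MM a b).map (fun c => (x ∪ y) :: c))
termination_by a b => a.length + b.length

lemma MM_nil {α : Type*} [DecidableEq α] (a : List (Finset α)) : MM a [] = [a] := by
  cases a <;> simp [MM]

lemma UU_of_mem_MM {α : Type*} [DecidableEq α] (a b c : List (Finset α)) (h : c ∈ MM a b) :
    UU c = UU a ∪ UU b := by
  induction a, b using MM.induct generalizing c with
  | case1 b => simp [MM] at h; simp [h, UU]
  | case2 x a => simp [MM] at h; simp [h, UU]
  | case3 x a y b ih1 ih2 ih3 =>
    simp only [MM, List.mem_append, List.mem_map] at h
    rcases h with ⟨d, hd, rfl⟩ | ⟨d, hd, rfl⟩ | ⟨d, hd, rfl⟩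
    · rw [UU_cons, ih1 d hd]; simp only [UU_cons]; ext; simp; try tauto
    · rw [UU_cons, ih2 d hd]; simp only [UU_cons]; ext; simp; try tauto
    · rw [UU_cons, ih3 d hd]; simp only [UU_cons]; ext; simp; try tauto

/-- multiplicativity hypothesis -/
def Mult {α : Type*} [DecidableEq α] (A B : Finset α) (T : Set (Finset α)) : Prop :=
  ∀ I J : Finset α, I ⊆ A → I ≠ ∅ → J ⊆ B → J ≠ ∅ →
    (I ∈ T → J ∈ T → I ∪ J ∈ T) ∧ (I ∉ T → J ∉ T → I ∪ J ∉ T)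

/-- blocks are nonempty subsets of A -/
def Blk {α : Type*} [DecidableEq α] (A : Finset α) (l : List (Finset α)) : Prop :=
  ∀ J ∈ l, J ≠ ∅ ∧ J ⊆ A

lemma Blk.UU_sub {α : Type*} [DecidableEq α] {A : Finset α} {l : List (Finset α)}
    (h : Blk A l) : UU l ⊆ A := by
  intro z hz
  obtain ⟨J, hJ, hz⟩ := (mem_UU _ _).1 hz
  exact (h J hJ).2 hz

lemma Blk.UU_ne {α : Type*} [DecidableEq α] {A : Finset α} {x : Finset α} {l : List (Finset α)}
    (h : Blk A (x :: l)) : UU (x :: l) ≠ ∅ := by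
  have := (h x (by simp)).1
  rw [UU_cons]
  simp [Finset.union_eq_empty, this]

lemma blk_cons {α : Type*} [DecidableEq α] {A : Finset α} {x : Finset α} {l : List (Finset α)} :
    Blk A (x :: l) ↔ (x ≠ ∅ ∧ x ⊆ A) ∧ Blk A l := by
  simp [Blk]

lemma sum_ite_neg {β : Type*} (l : List β) (p : Prop) (f : β → ℂ) :
    (l.map (fun c => if p then - f c else 0)).sum = if p then - (l.map f).sum else 0 := by
  by_cases h : p
  · simp only [h, if_true]
    induction l with
    | nil => simp
    | cons x l ih => simp [ih]; ring
  · simp [h]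

lemma sum_wt {α : Type*} [DecidableEq α] (A B : Finset α) (T : Set (Finset α))
    (hT : Mult A B T) (a b : List (Finset α)) (ha : Blk A a) (hb : Blk B b) :
    ((MM a b).map (wt T)).sum = wt T a * wt T b := by
  induction a, b using MM.induct with
  | case1 b => simp [MM, wt_nil]
  | case2 x a => simp [MM, wt_nil]
  | case3 x a y b ih1 ih2 ih3 =>
    have ha' := (blk_cons.1 ha).2
    have hb' := (blk_cons.1 hb).2
    have e1 : (MM a (y :: b)).map (fun c => wt T (x :: c)) = (MM a (y :: b)).map
        (fun c => if UU (x :: a) ∪ UU (y :: b) ∈ T then - wt T c else 0) := by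
      apply List.map_congr_left
      intro c hc
      rw [wt_cons]
      have : UU (x :: c) = UU (x :: a) ∪ UU (y :: b) := by
        rw [UU_cons, UU_of_mem_MM _ _ _ hc, UU_cons x a, Finset.union_assoc]
      rw [this]
    have e2 : (MM (x :: a) b).map (fun c => wt T (y :: c)) = (MM (x :: a) b).map
        (fun c => if UU (x :: a) ∪ UU (y :: b) ∈ T then - wt T c else 0) := by
      apply List.map_congr_left
      intro c hc
      rw [wt_cons]
      have : UU (y :: c) = UU (x :: a) ∪ UU (y :: b) := by
        rw [UU_cons, UU_of_mem_MM _ _ _ hc, UU_cons y b, Finset.union_left_comm]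
      rw [this]
    have e3 : (MM a b).map (fun c => wt T ((x ∪ y) :: c)) = (MM a b).map
        (fun c => if UU (x :: a) ∪ UU (y :: b) ∈ T then - wt T c else 0) := by
      apply List.map_congr_left
      intro c hc
      rw [wt_cons]
      have : UU ((x ∪ y) :: c) = UU (x :: a) ∪ UU (y :: b) := by
        rw [UU_cons, UU_of_mem_MM _ _ _ hc, UU_cons y b, UU_cons x a]
        ext; simp; tauto
      rw [this]
    simp only [MM, List.map_append, List.map_map, List.sum_append, Function.comp_def]
    rw [e1, e2, e3, sum_ite_neg, sum_ite_neg, sum_ite_neg, ih1 ha' hb, ih2 ha hb', ih3 ha' hb',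
      wt_cons T x a, wt_cons T y b]
    obtain ⟨h1, h2⟩ := hT (UU (x :: a)) (UU (y :: b)) ha.UU_sub ha.UU_ne hb.UU_sub hb.UU_ne
    by_cases t1 : UU (x :: a) ∈ T <;> by_cases t2 : UU (y :: b) ∈ T
    · simp [t1, t2, h1 t1 t2]
    · simp only [t1, t2, if_true, if_false]; split_ifs <;> ring
    · simp only [t1, t2, if_true, if_false]; split_ifs <;> ring
    · simp [t1, t2, h2 t1 t2]

/-- trace -/
noncomputable def tr {α : Type*} [DecidableEq α] (A : Finset α) (c : List (Finset α)) :
    List (Finset α) := (c.map fun J => J ∩ A).filter fun J => J ≠ ∅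

lemma tr_cons {α : Type*} [DecidableEq α] (A x : Finset α) (c : List (Finset α)) :
    tr A (x :: c) = if x ∩ A = ∅ then tr A c else (x ∩ A) :: tr A c := by
  by_cases h : x ∩ A = ∅
  · simp [tr, h]
  · simp [tr, h]

lemma tr_append {α : Type*} [DecidableEq α] (A : Finset α) (c d : List (Finset α)) :
    tr A (c ++ d) = tr A c ++ tr A d := by simp [tr]

lemma tr_reverse {α : Type*} [DecidableEq α] (A : Finset α) (c : List (Finset α)) :
    tr A c.reverse = (tr A c).reverse := by simp [tr]

lemma tr_nil {α : Type*} [DecidableEq α] (A : Finset α) : tr A [] = [] := by simp [tr]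

lemma mem_tr {α : Type*} [DecidableEq α] (A : Finset α) (c : List (Finset α)) (K : Finset α) :
    K ∈ tr A c ↔ K ≠ ∅ ∧ ∃ J ∈ c, J ∩ A = K := by simp [tr, and_comm]

lemma tr_self {α : Type*} [DecidableEq α] (A : Finset α) (c : List (Finset α)) (h : Blk A c) :
    tr A c = c := by
  induction c with
  | nil => simp [tr]
  | cons x c ih =>
    obtain ⟨⟨h1, h2⟩, h3⟩ := blk_cons.1 h
    rw [tr_cons, ih h3, Finset.inter_eq_left.2 h2, if_neg h1]

lemma tr_disj {α : Type*} [DecidableEq α] (A B : Finset α) (hAB : Disjoint A B)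
    (c : List (Finset α)) (h : Blk A c) :
    tr B c = [] := by
  induction c with
  | nil => simp [tr]
  | cons x c ih =>
    obtain ⟨⟨h1, h2⟩, h3⟩ := blk_cons.1 h
    rw [tr_cons, ih h3, if_pos]
    exact Finset.disjoint_iff_inter_eq_empty.1 (hAB.mono_left h2)

lemma Blk.mono {α : Type*} [DecidableEq α] {A B : Finset α} {c : List (Finset α)}
    (h : Blk A c) (hAB : A ⊆ B) : Blk B c := fun J hJ => ⟨(h J hJ).1, (h J hJ).2.trans hAB⟩

lemma mem_MM_of {α : Type*} [DecidableEq α] (A B : Finset α) (c : List (Finset α))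
    (h : Blk (A ∪ B) c) : c ∈ MM (tr A c) (tr B c) := by
  induction c with
  | nil => simp [tr, MM]
  | cons x c ih =>
    obtain ⟨⟨h1, h2⟩, h3⟩ := blk_cons.1 h
    have ih := ih h3
    have hx : x = x ∩ A ∪ x ∩ B := by
      rw [← Finset.inter_union_distrib_left, Finset.inter_eq_left.2 h2]
    rw [tr_cons, tr_cons]
    by_cases hA : x ∩ A = ∅
    · by_cases hB : x ∩ B = ∅
      · rw [hA, hB] at hx; simp at hx; exact absurd hx h1
      · rw [if_pos hA, if_neg hB]
        have hx' : x ∩ B = x := by rw [hA] at hx; simpa using hx.symm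
        rw [hx']
        revert ih
        cases tr A c with
        | nil => simp [MM]
        | cons y a => intro ih; simp [MM, ih]
    · by_cases hB : x ∩ B = ∅
      · rw [if_neg hA, if_pos hB]
        have hx' : x ∩ A = x := by rw [hB] at hx; simpa using hx.symm
        rw [hx']
        revert ih
        cases tr B c with
        | nil => simp [MM, MM_nil]
        | cons y a => intro ih; simp [MM, ih]
      · rw [if_neg hA, if_neg hB]
        simp only [MM, List.mem_append, List.mem_map]
        right; right
        exact ⟨c, ih, by rw [← hx]⟩

lemma of_mem_MM {α : Type*} [DecidableEq α] (A B : Finset α) (hAB : Disjoint A B)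
    (a b c : List (Finset α)) (ha : Blk A a) (hb : Blk B b) (h : c ∈ MM a b) :
    Blk (A ∪ B) c ∧ tr A c = a ∧ tr B c = b := by
  induction a, b using MM.induct generalizing c with
  | case1 b =>
    simp [MM] at h; subst h
    exact ⟨hb.mono Finset.subset_union_right, tr_disj _ _ hAB.symm _ hb, tr_self _ _ hb⟩
  | case2 x a =>
    simp [MM] at h; subst h
    exact ⟨ha.mono Finset.subset_union_left, tr_self _ _ ha, tr_disj _ _ hAB _ ha⟩
  | case3 x a y b ih1 ih2 ih3 =>
    obtain ⟨⟨hx1, hx2⟩, ha'⟩ := blk_cons.1 ha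
    obtain ⟨⟨hy1, hy2⟩, hb'⟩ := blk_cons.1 hb
    have xA : x ∩ A = x := Finset.inter_eq_left.2 hx2
    have yB : y ∩ B = y := Finset.inter_eq_left.2 hy2
    have xB : x ∩ B = ∅ := Finset.disjoint_iff_inter_eq_empty.1 (hAB.mono_left hx2)
    have yA : y ∩ A = ∅ := Finset.disjoint_iff_inter_eq_empty.1 (hAB.symm.mono_left hy2)
    simp only [MM, List.mem_append, List.mem_map] at h
    rcases h with ⟨d, hd, rfl⟩ | ⟨d, hd, rfl⟩ | ⟨d, hd, rfl⟩
    · obtain ⟨i1, i2, i3⟩ := ih1 d ha' hb hd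
      refine ⟨blk_cons.2 ⟨⟨hx1, hx2.trans Finset.subset_union_left⟩, i1⟩, ?_, ?_⟩
      · rw [tr_cons, xA, if_neg hx1, i2]
      · rw [tr_cons, if_pos xB, i3]
    · obtain ⟨i1, i2, i3⟩ := ih2 d ha hb' hd
      refine ⟨blk_cons.2 ⟨⟨hy1, hy2.trans Finset.subset_union_right⟩, i1⟩, ?_, ?_⟩
      · rw [tr_cons, if_pos yA, i2]
      · rw [tr_cons, yB, if_neg hy1, i3]
    · obtain ⟨i1, i2, i3⟩ := ih3 d ha' hb' hd
      refine ⟨blk_cons.2 ⟨⟨?_, Finset.union_subset_union hx2 hy2⟩, i1⟩, ?_, ?_⟩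
      · simp [Finset.union_eq_empty, hx1]
      · rw [tr_cons, Finset.union_inter_distrib_right, xA, yA, Finset.union_empty, if_neg hx1, i2]
      · rw [tr_cons, Finset.union_inter_distrib_right, xB, yB, Finset.empty_union, if_neg hy1, i3]

lemma MM_nodup {α : Type*} [DecidableEq α] (A B : Finset α) (hAB : Disjoint A B)
    (a b : List (Finset α)) (ha : Blk A a) (hb : Blk B b) : (MM a b).Nodup := by
  induction a, b using MM.induct with
  | case1 b => simp [MM]
  | case2 x a => simp [MM]
  | case3 x a y b ih1 ih2 ih3 =>
    obtain ⟨⟨hx1, hx2⟩, ha'⟩ := blk_cons.1 ha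
    obtain ⟨⟨hy1, hy2⟩, hb'⟩ := blk_cons.1 hb
    have hd : Disjoint x y := hAB.mono hx2 hy2
    have hxy : x ≠ y := by
      rintro rfl; exact hx1 (by simpa using hd)
    have h1 : x ≠ x ∪ y := by
      intro h
      have : y ⊆ x := by rw [h]; exact Finset.subset_union_right
      exact hy1 (Finset.disjoint_self_iff_empty y |>.1 (hd.mono_left this))
    have h2 : y ≠ x ∪ y := by
      intro h
      have : x ⊆ y := by rw [h]; exact Finset.subset_union_left
      exact hx1 (Finset.disjoint_self_iff_empty x |>.1 (hd.mono_right this))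
    simp only [MM]
    refine List.Nodup.append ((ih1 ha' hb).map (List.cons_injective)) (List.Nodup.append
      ((ih2 ha hb').map (List.cons_injective)) ((ih3 ha' hb').map (List.cons_injective)) ?_) ?_
    · intro c hc hc'
      simp only [List.mem_map] at hc hc'
      obtain ⟨d, _, rfl⟩ := hc
      obtain ⟨d', _, h⟩ := hc'
      exact h2 (List.cons.inj h).1.symm
    · intro c hc hc'
      simp only [List.mem_append, List.mem_map] at hc hc'
      obtain ⟨d, _, rfl⟩ := hc
      rcases hc' with ⟨d', _, h⟩ | ⟨d', _, h⟩
      · exact hxy (List.cons.inj h).1.symm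
      · exact h1 (List.cons.inj h).1.symm

lemma sum_wt' {α : Type*} [DecidableEq α] (A B : Finset α) (hAB : Disjoint A B)
    (T : Set (Finset α))
    (hT : Mult A B T) (a b : List (Finset α)) (ha : Blk A a) (hb : Blk B b) :
    ∑ c ∈ (MM a b).toFinset, wt T c = wt T a * wt T b := by
  rw [List.sum_toFinset _ (MM_nodup A B hAB a b ha hb), sum_wt A B T hT a b ha hb]

lemma UU_reverse {α : Type*} [DecidableEq α] (l : List (Finset α)) : UU l.reverse = UU l := by
  ext z; simp [mem_UU]

lemma UU_append {α : Type*} [DecidableEq α] (l m : List (Finset α)) :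
    UU (l ++ m) = UU l ∪ UU m := by
  ext z; simp only [mem_UU, List.mem_append, Finset.mem_union]; grind

lemma proper_tr {α : Type*} [DecidableEq α] {X A : Finset α} {c : List (Finset α)}
    (h : IsProperSeq X c) (hA : A ⊆ X) (hne : A ≠ ∅) : IsProperSeq A (tr A c) := by
  obtain ⟨h1, h2, h3, h4⟩ := h
  have hU : UU (tr A c) = A := by
    ext z
    simp only [mem_UU, mem_tr]
    constructor
    · rintro ⟨K, ⟨_, J, _, rfl⟩, hz⟩
      exact (Finset.mem_inter.1 hz).2
    · intro hz
      have : z ∈ UU c := by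
        have h4 : UU c = X := h4
        rw [h4]; exact hA hz
      obtain ⟨J, hJ, hzJ⟩ := (mem_UU _ _).1 this
      have hz' : z ∈ J ∩ A := Finset.mem_inter.2 ⟨hzJ, hz⟩
      exact ⟨J ∩ A, ⟨Finset.ne_empty_of_mem hz', J, hJ, rfl⟩, hz'⟩
  refine ⟨?_, fun J hJ => ((mem_tr _ _ _).1 hJ).1, ?_, hU⟩
  · intro h; rw [h] at hU; exact hne hU.symm
  · unfold tr
    rw [List.pairwise_filter, List.pairwise_map]
    refine h3.imp ?_
    intro I J hIJ _ _
    ext z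
    have : z ∉ I ∩ J := by simp [hIJ]
    simp at this ⊢
    tauto

lemma proper_of_tr {α : Type*} [DecidableEq α] {A B : Finset α} {c : List (Finset α)}
    (hc : Blk (A ∪ B) c) (hA : IsProperSeq A (tr A c)) (hB : IsProperSeq B (tr B c)) :
    IsProperSeq (A ∪ B) c := by
  obtain ⟨a1, a2, a3, a4⟩ := hA
  obtain ⟨b1, b2, b3, b4⟩ := hB
  refine ⟨?_, fun J hJ => (hc J hJ).1, ?_, ?_⟩
  · rintro rfl; exact a1 (tr_nil _)
  · unfold tr at a3 b3
    rw [List.pairwise_filter, List.pairwise_map] at a3 b3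
    refine List.Pairwise.imp_of_mem ?_ (a3.and b3)
    rintro I J hI hJ ⟨h1, h2⟩
    by_contra hne
    obtain ⟨z, hz⟩ := Finset.nonempty_iff_ne_empty.2 hne
    obtain ⟨hzI, hzJ⟩ := Finset.mem_inter.1 hz
    rcases Finset.mem_union.1 ((hc I hI).2 hzI) with hz | hz
    · have e1 : z ∈ I ∩ A := Finset.mem_inter.2 ⟨hzI, hz⟩
      have e2 : z ∈ J ∩ A := Finset.mem_inter.2 ⟨hzJ, hz⟩
      have := h1 (by simpa using Finset.ne_empty_of_mem e1) (by simpa using Finset.ne_empty_of_mem e2)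
      have h := Finset.mem_inter.2 ⟨e1, e2⟩
      rw [this] at h; simp at h
    · have e1 : z ∈ I ∩ B := Finset.mem_inter.2 ⟨hzI, hz⟩
      have e2 : z ∈ J ∩ B := Finset.mem_inter.2 ⟨hzJ, hz⟩
      have := h2 (by simpa using Finset.ne_empty_of_mem e1) (by simpa using Finset.ne_empty_of_mem e2)
      have h := Finset.mem_inter.2 ⟨e1, e2⟩
      rw [this] at h; simp at h
  · change UU (tr A c) = A at a4
    change UU (tr B c) = B at b4
    change UU c = A ∪ B
    apply Finset.Subset.antisymm hc.UU_sub
    intro z hz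
    rw [← a4, ← b4] at hz
    simp only [Finset.mem_union, mem_UU, mem_tr] at hz ⊢
    rcases hz with ⟨K, ⟨_, J, hJ, rfl⟩, hz⟩ | ⟨K, ⟨_, J, hJ, rfl⟩, hz⟩
    · exact ⟨J, hJ, (Finset.mem_inter.1 hz).1⟩
    · exact ⟨J, hJ, (Finset.mem_inter.1 hz).1⟩

lemma split_proper {α : Type*} [DecidableEq α] {Y : Finset α} {l m : List (Finset α)}
    (h : IsProperSeq Y (l ++ m)) (hl : l ≠ []) (hm : m ≠ []) :
    IsProperSubset Y (UU l) ∧ Y \ UU l = UU m := by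
  obtain ⟨h1, h2, h3, h4⟩ := h
  have h4 : UU (l ++ m) = Y := h4
  rw [UU_append] at h4
  rw [List.pairwise_append] at h3
  have hd : ∀ z, z ∈ UU l → z ∈ UU m → False := by
    intro z hz hz'
    obtain ⟨I, hI, hzI⟩ := (mem_UU _ _).1 hz
    obtain ⟨J, hJ, hzJ⟩ := (mem_UU _ _).1 hz'
    have := h3.2.2 I hI J hJ
    have h := Finset.mem_inter.2 ⟨hzI, hzJ⟩
    rw [this] at h; simp at h
  have hn : ∀ k : List (Finset α), k ≠ [] → (∀ J ∈ k, J ≠ ∅) → ∃ z, z ∈ UU k := by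
    intro k hk hk'
    obtain ⟨J, hJ⟩ := List.exists_mem_of_ne_nil k hk
    obtain ⟨z, hz⟩ := Finset.nonempty_iff_ne_empty.2 (hk' J hJ)
    exact ⟨z, (mem_UU _ _).2 ⟨J, hJ, hz⟩⟩
  obtain ⟨z, hz⟩ := hn l hl (fun J hJ => h2 J (by simp [hJ]))
  obtain ⟨z', hz'⟩ := hn m hm (fun J hJ => h2 J (by simp [hJ]))
  refine ⟨⟨by rw [← h4]; exact Finset.subset_union_left, Finset.ne_empty_of_mem hz, ?_⟩, ?_⟩
  · intro h
    exact hd z' (by rw [h, ← h4]; exact Finset.mem_union_right _ hz') hz'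
  · ext w
    rw [← h4]
    simp only [Finset.mem_sdiff, Finset.mem_union]
    have := hd w
    tauto

lemma chain_iff {α : Type*} [DecidableEq α] (Y : Finset α) (T S S' : Set (Finset α)) (o : α)
    (c1 c2 : List (Finset α)) (J : Finset α) (hp : IsProperSeq Y (c1.reverse ++ J :: c2))
    (ho : o ∈ J)
    (h1 : ∀ K, IsProperSubset Y K → o ∉ K → (K ∈ T ↔ K ∈ S'))
    (h2 : ∀ K, IsProperSubset Y K → o ∈ K → (K ∈ T ↔ Y \ K ∈ S)) :
    IsChainFor Y T (c1.reverse ++ J :: c2) ↔ Good S' c1 ∧ Good S c2 := by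
  have hlen : (c1.reverse ++ J :: c2).length = c1.length + 1 + c2.length := by simp; omega
  have key : ∀ r, 0 < r → r < (c1.reverse ++ J :: c2).length →
      IsProperSubset Y (UU ((c1.reverse ++ J :: c2).take r)) ∧
      Y \ UU ((c1.reverse ++ J :: c2).take r) = UU ((c1.reverse ++ J :: c2).drop r) := by
    intro r hr hr'
    apply split_proper
    · rwa [List.take_append_drop]
    · intro h
      have := congrArg List.length h
      rw [List.length_take] at this
      simp only [List.length_nil] at this
      omega
    · intro h
      have := congrArg List.length h
      rw [List.length_drop] at this
      simp only [List.length_nil] at this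
      omega
  have front : ∀ k, k < c1.length →
      (UU ((c1.reverse ++ J :: c2).take (c1.length - k)) ∈ T ↔ UU (c1.drop k) ∈ S') := by
    intro k hk
    have e : UU ((c1.reverse ++ J :: c2).take (c1.length - k)) = UU (c1.drop k) := by
      rw [List.take_append_of_le_length (by simp), List.take_reverse, UU_reverse]
      congr 2; omega
    obtain ⟨k1, k2⟩ := key (c1.length - k) (by omega) (by omega)
    rw [e] at k1 k2 ⊢
    apply h1 _ k1
    have : o ∈ UU ((c1.reverse ++ J :: c2).drop (c1.length - k)) := by
      rw [mem_UU]
      refine ⟨J, ?_, ho⟩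
      rw [List.drop_append_of_le_length (by simp)]
      simp
    rw [← k2] at this
    exact (Finset.mem_sdiff.1 this).2
  have back : ∀ k, k < c2.length →
      (UU ((c1.reverse ++ J :: c2).take (c1.length + 1 + k)) ∈ T ↔ UU (c2.drop k) ∈ S) := by
    intro k hk
    have e : (c1.reverse ++ J :: c2).drop (c1.length + 1 + k) = c2.drop k := by
      have : c1.length + 1 + k = c1.reverse.length + (k + 1) := by simp; omega
      rw [this, List.drop_append]; simp
    obtain ⟨k1, k2⟩ := key (c1.length + 1 + k) (by omega) (by omega)
    rw [h2 _ k1, k2, e]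
    rw [mem_UU]
    refine ⟨J, ?_, ho⟩
    have : c1.length + 1 + k = c1.reverse.length + (k + 1) := by simp; omega
    rw [this, List.take_append]; simp
  rw [good_iff, good_iff]
  constructor
  · rintro ⟨_, h⟩
    exact ⟨fun k hk => (front k hk).1 (h _ (by omega) (by omega)),
      fun k hk => (back k hk).1 (h _ (by omega) (by omega))⟩
  · rintro ⟨g1, g2⟩
    refine ⟨hp, fun r hr hr' => ?_⟩
    by_cases hle : r ≤ c1.length
    · have := (front (c1.length - r) (by omega)).2 (g1 _ (by omega))
      rwa [show c1.length - (c1.length - r) = r by omega] at this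
    · have := (back (r - c1.length - 1) (by omega)).2 (g2 _ (by omega))
      rwa [show c1.length + 1 + (r - c1.length - 1) = r by omega] at this

lemma US_apply {α : Type*} [DecidableEq α] [Fintype α] (Y : Finset α) (T : Set (Finset α))
    (c : List (Finset α)) :
    US Y T c = if IsChainFor Y T c then (-1 : ℂ) ^ (c.length - 1) else 0 := rfl

lemma US_eq_wt {α : Type*} [DecidableEq α] [Fintype α] (Y : Finset α)
    (T S S' : Set (Finset α)) (o : α)
    (c1 c2 : List (Finset α)) (J : Finset α) (hp : IsProperSeq Y (c1.reverse ++ J :: c2))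
    (ho : o ∈ J)
    (h1 : ∀ K, IsProperSubset Y K → o ∉ K → (K ∈ T ↔ K ∈ S'))
    (h2 : ∀ K, IsProperSubset Y K → o ∈ K → (K ∈ T ↔ Y \ K ∈ S)) :
    US Y T (c1.reverse ++ J :: c2) = wt S' c1 * wt S c2 := by
  rw [US_apply]
  have := chain_iff Y T S S' o c1 c2 J hp ho h1 h2
  simp only [this]
  by_cases g1 : Good S' c1 <;> by_cases g2 : Good S c2 <;> simp [wt, g1, g2, pow_add]

lemma decomp {α : Type*} [DecidableEq α] {Z : Finset α} {o : α} {c : List (Finset α)}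
    (h : IsProperSeq (insert o Z) c) :
    ∃ c1 J c2, c = c1.reverse ++ J :: c2 ∧ o ∈ J ∧ Blk Z c1 ∧ Blk Z c2 ∧ J ⊆ insert o Z := by
  obtain ⟨h1, h2, h3, h4⟩ := h
  have h4 : UU c = insert o Z := h4
  have : o ∈ UU c := by rw [h4]; simp
  obtain ⟨J, hJ, hoJ⟩ := (mem_UU _ _).1 this
  obtain ⟨s, t, rfl⟩ := List.append_of_mem hJ
  have hsub : ∀ K ∈ s ++ J :: t, K ⊆ insert o Z := by
    intro K hK z hz
    rw [← h4]; exact (mem_UU _ _).2 ⟨K, hK, hz⟩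
  have hZ : ∀ K ∈ s ++ J :: t, K ∩ J = ∅ → K ⊆ Z := by
    intro K hK hd z hz
    rcases Finset.mem_insert.1 (hsub K hK hz) with rfl | h
    · have := Finset.mem_inter.2 ⟨hz, hoJ⟩
      rw [hd] at this; simp at this
    · exact h
  rw [List.pairwise_append, List.pairwise_cons] at h3
  refine ⟨s.reverse, J, t, by simp, hoJ, ?_, ?_, hsub J hJ⟩
  · intro K hK
    have hK' : K ∈ s := by simpa using hK
    have hm : K ∈ s ++ J :: t := by simp [hK']
    exact ⟨h2 K hm, hZ K hm (h3.2.2 K hK' J (by simp))⟩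
  · intro K hK
    have hm : K ∈ s ++ J :: t := by simp [hK]
    refine ⟨h2 K hm, hZ K hm ?_⟩
    rw [Finset.inter_comm]; exact h3.2.1.1 K hK

lemma split_unique {α : Type*} [DecidableEq α] (o : α) (l l' m m' : List (Finset α))
    (x x' : Finset α) (hx : o ∈ x) (hx' : o ∈ x') (hl : ∀ J ∈ l, o ∉ J) (hl' : ∀ J ∈ l', o ∉ J)
    (h : l ++ x :: m = l' ++ x' :: m') : l = l' ∧ x = x' ∧ m = m' := by
  induction l generalizing l' with
  | nil =>
    cases l' with
    | nil => simpa using h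
    | cons y l' =>
      simp at h
      exact absurd (h.1 ▸ hx) (hl' y (by simp))
  | cons z l ih =>
    cases l' with
    | nil =>
      simp at h
      exact absurd (h.1 ▸ hx') (hl z (by simp))
    | cons y l' =>
      simp only [List.cons_append, List.cons.injEq] at h
      obtain ⟨rfl, h⟩ := h
      obtain ⟨rfl, h'⟩ := ih l' (fun J hJ => hl J (by simp [hJ])) (fun J hJ => hl' J (by simp [hJ])) h
      exact ⟨rfl, h'⟩

lemma tr_insert {α : Type*} [DecidableEq α] (o : α) (A Z : Finset α) (c : List (Finset α))
    (hc : Blk Z c) (ho : o ∉ Z) : tr (insert o A) c = tr A c := by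
  unfold tr
  congr 1
  apply List.map_congr_left
  intro J hJ
  have : o ∉ J := fun h => ho ((hc J hJ).2 h)
  rw [Finset.inter_insert_of_notMem this]

lemma Fac_apply {α : Type*} [DecidableEq α] (A1 B1 : Finset α) (x : AX α)
    (a b : List (Finset α)) :
    Fac A1 B1 x (a, b) =
      ∑ c ∈ x.support.filter (fun c => tr A1 c = a ∧ tr B1 c = b), x c := by
  unfold Fac
  rw [Finsupp.sum, Finsupp.finsetSum_apply, Finset.sum_filter]
  apply Finset.sum_congr rfl
  intro c _
  rw [Finsupp.single_apply]
  have : facSeq A1 B1 c = (tr A1 c, tr B1 c) := rfl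
  simp [this]

lemma tens_apply {α : Type*} [DecidableEq α] (u v : AX α) (a b : List (Finset α)) :
    tens u v (a, b) = u a * v b := by
  unfold tens
  rw [Finsupp.sum, Finsupp.finsetSum_apply]
  rw [Finset.sum_eq_single a]
  · rw [Finsupp.sum, Finsupp.finsetSum_apply, Finset.sum_eq_single b]
    · simp
    · intro b' _ h; simp [Finsupp.single_apply, h]
    · intro h; simp at h; simp [h]
  · intro a' _ h
    rw [Finsupp.sum, Finsupp.finsetSum_apply]
    apply Finset.sum_eq_zero
    intro b' _; simp [Finsupp.single_apply, h]
  · intro h; simp at h; simp [h]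

lemma blk_notMem {α : Type*} [DecidableEq α] {Z : Finset α} {o : α} {c : List (Finset α)}
    (hc : Blk Z c) (ho : o ∉ Z) : ∀ J ∈ c, o ∉ J := fun J hJ h => ho ((hc J hJ).2 h)

lemma tr_mid {α : Type*} [DecidableEq α] {o : α} {A Z J : Finset α} {c1 c2 : List (Finset α)}
    (hc1 : Blk Z c1) (hc2 : Blk Z c2) (ho : o ∉ Z) (hJ : o ∈ J) :
    tr (insert o A) (c1.reverse ++ J :: c2) =
      (tr A c1).reverse ++ (J ∩ insert o A) :: tr A c2 := by
  have : o ∈ J ∩ insert o A := by simp [hJ]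
  rw [tr_append, tr_reverse, tr_cons, if_neg (Finset.ne_empty_of_mem this),
    tr_insert o A Z c1 hc1 ho, tr_insert o A Z c2 hc2 ho]

lemma tr_blk {α : Type*} [DecidableEq α] (A : Finset α) (c : List (Finset α)) :
    Blk A (tr A c) := by
  intro K hK
  obtain ⟨h, J, _, rfl⟩ := (mem_tr _ _ _).1 hK
  exact ⟨h, Finset.inter_subset_right⟩

lemma tr_mid_eq {α : Type*} [DecidableEq α] {o : α} {A Z J x : Finset α}
    {c1 c2 a1 a2 : List (Finset α)}
    (hc1 : Blk Z c1) (hc2 : Blk Z c2) (ho : o ∉ Z) (hJ : o ∈ J) (hoA : o ∉ A) (hx : o ∈ x)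
    (ha1 : Blk A a1)
    (h : tr (insert o A) (c1.reverse ++ J :: c2) = a1.reverse ++ x :: a2) :
    tr A c1 = a1 ∧ J ∩ insert o A = x ∧ tr A c2 = a2 := by
  rw [tr_mid hc1 hc2 ho hJ] at h
  obtain ⟨h1, h2, h3⟩ := split_unique o _ _ _ _ _ _ (by simp [hJ]) hx
    (fun K hK => blk_notMem (tr_blk A c1) hoA K (by simpa using hK))
    (fun K hK => blk_notMem ha1 hoA K (by simpa using hK)) h
  exact ⟨List.reverse_injective h1, h2, h3⟩

/-- `restCell` satisfies the comparison hypotheses. -/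
lemma rest_h1 {α : Type*} [DecidableEq α] (A : Finset α) (o : α) (S S' : Set (Finset α))
    (K : Finset α) (hK : IsProperSubset (insert o A) K) (ho : o ∉ K) :
    K ∈ restCell A o S' S ↔ K ∈ S' := by
  have : K ⊆ A := (Finset.subset_insert_iff_of_notMem ho).1 hK.1
  simp [restCell, hK, ho, this]

lemma rest_h2 {α : Type*} [DecidableEq α] (A : Finset α) (o : α) (hoA : o ∉ A)
    (S S' : Set (Finset α))
    (K : Finset α) (hK : IsProperSubset (insert o A) K) (ho : o ∈ K) :
    K ∈ restCell A o S' S ↔ insert o A \ K ∈ S := by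
  have h1 : ¬ K ⊆ A := fun h => hoA (h ho)
  have h2 : insert o A \ K = A \ K := Finset.insert_sdiff_of_mem _ ho
  simp [restCell, hK, ho, h1, h2]

lemma mult_S {α : Type*} [DecidableEq α] (A B : Finset α) (o : α) (hAB : Disjoint A B)
    (hoA : o ∉ A) (hoB : o ∉ B) (S : Set (Finset α))
    (hS : IsPrecell (insert o (A ∪ B)) S) : Mult A B S := by
  obtain ⟨⟨_, hp, hc⟩, hd⟩ := hS
  intro I J hI hI' hJ hJ'
  have hpr : ∀ K, K ⊆ A ∪ B → K ≠ ∅ → IsProperSubset (insert o (A ∪ B)) K := by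
    intro K hK hK'
    refine ⟨hK.trans (Finset.subset_insert _ _), hK', ?_⟩
    rintro rfl
    have := hK (Finset.mem_insert_self _ _)
    simp [hoA, hoB] at this
  have hIJ : I ∩ J = ∅ := Finset.disjoint_iff_inter_eq_empty.1 (hAB.mono hI hJ)
  constructor
  · intro h1 h2
    rcases hc I h1 J h2 with h | h
    · rw [hIJ] at h; exact absurd rfl (hp _ h).2.1
    · exact h
  · intro h1 h2 h3
    have g1 := (hd I (hpr I (hI.trans Finset.subset_union_left) hI')).resolve_left h1
    have g2 := (hd J (hpr J (hJ.trans Finset.subset_union_right) hJ')).resolve_left h2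
    have e1 : insert o (A ∪ B) \ I ∩ (insert o (A ∪ B) \ J) = insert o (A ∪ B) \ (I ∪ J) := by
      ext z; simp only [Finset.mem_inter, Finset.mem_sdiff, Finset.mem_union]; tauto
    have e2 : insert o (A ∪ B) \ I ∪ (insert o (A ∪ B) \ J) = insert o (A ∪ B) := by
      rw [← Finset.sdiff_inter_distrib_right, hIJ, Finset.sdiff_empty]
    rcases hc _ g1 _ g2 with h | h
    · rw [e1] at h
      rcases hc _ h3 _ h with h | h
      · rw [Finset.inter_sdiff_self] at h; exact (hp _ h).2.1 rfl
      · rw [Finset.union_sdiff_of_subset (hp _ h3).1] at h; exact (hp _ h).2.2 rfl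
    · rw [e2] at h; exact (hp _ h).2.2 rfl

lemma opp_iff {α : Type*} [DecidableEq α] (X : Finset α) (S : Set (Finset α))
    (hS : IsPrecell X S) (K : Finset α) (hK : IsProperSubset X K) : K ∈ opp X S ↔ K ∉ S := by
  obtain ⟨⟨_, hp, hc⟩, hd⟩ := hS
  constructor
  · rintro ⟨_, h⟩ h3
    rcases hc _ h3 _ h with h | h
    · rw [Finset.inter_sdiff_self] at h; exact (hp _ h).2.1 rfl
    · rw [Finset.union_sdiff_of_subset hK.1] at h; exact (hp _ h).2.2 rfl
  · intro h
    exact ⟨hK.1, (hd K hK).resolve_left h⟩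

lemma mult_opp {α : Type*} [DecidableEq α] (A B : Finset α) (o : α) (hAB : Disjoint A B)
    (hoA : o ∉ A) (hoB : o ∉ B) (S : Set (Finset α))
    (hS : IsPrecell (insert o (A ∪ B)) S) : Mult A B (opp (insert o (A ∪ B)) S) := by
  have hm := mult_S A B o hAB hoA hoB S hS
  have hpr : ∀ K, K ⊆ A ∪ B → K ≠ ∅ → IsProperSubset (insert o (A ∪ B)) K := by
    intro K hK hK'
    refine ⟨hK.trans (Finset.subset_insert _ _), hK', ?_⟩
    rintro rfl
    have := hK (Finset.mem_insert_self _ _)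
    simp [hoA, hoB] at this
  intro I J hI hI' hJ hJ'
  have := hm I J hI hI' hJ hJ'
  rw [opp_iff _ _ hS _ (hpr I (hI.trans Finset.subset_union_left) hI'),
    opp_iff _ _ hS _ (hpr J (hJ.trans Finset.subset_union_right) hJ'),
    opp_iff _ _ hS _ (hpr (I ∪ J) (Finset.union_subset_union hI hJ) (by
      simp [Finset.union_eq_empty, hI']))]
  tauto

/-- Algebraic factorization theorem: `Fac(U_S) = U_{(S‖1,A)} ⊗ U_{(S‖1,B)}`. -/
theorem Fac_US {α : Type*} [DecidableEq α] [Fintype α] (A B : Finset α) (o : α)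
    (hA : A.Nonempty) (hB : B.Nonempty) (hAB : Disjoint A B)
    (hoA : o ∉ A) (hoB : o ∉ B)
    (X : Finset α) (hX : X = insert o (A ∪ B))
    (S : Set (Finset α)) (hS : IsPrecell X S) :
    Fac (insert o A) (insert o B) (US X (opp X S)) =
      tens (US (insert o A) (restCell A o (opp X S) S))
           (US (insert o B) (restCell B o (opp X S) S)) := by
  have hoZ : o ∉ A ∪ B := by simp [hoA, hoB]
  have hXAB : X = insert o A ∪ insert o B := by rw [hX]; ext; simp
  have hmS : Mult A B S := mult_S A B o hAB hoA hoB S (hX ▸ hS)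
  have hmO : Mult A B (opp X S) := by
    have := mult_opp A B o hAB hoA hoB S (hX ▸ hS)
    rwa [← hX] at this
  have hsupp : ∀ c, US X (opp X S) c ≠ 0 → IsProperSeq X c := by
    intro c hc
    by_contra h
    exact hc (by rw [US_apply, if_neg (fun h' => h h'.1)])
  ext ⟨a, b⟩
  rw [Fac_apply, tens_apply]
  by_cases hp : IsProperSeq (insert o A) a ∧ IsProperSeq (insert o B) b
  · obtain ⟨hpa, hpb⟩ := hp
    obtain ⟨a1, x, a2, rfl, hox, ha1, ha2, hxs⟩ := decomp hpa
    obtain ⟨b1, y, b2, rfl, hoy, hb1, hb2, hys⟩ := decomp hpb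
    have hxyA : (x ∪ y) ∩ insert o A = x := by
      ext z
      have h1 := @hxs z
      have h2 := @hys z
      have h3 : z ∈ A → z ∉ B := fun h => Finset.disjoint_left.1 hAB h
      simp only [Finset.mem_inter, Finset.mem_union, Finset.mem_insert] at h1 h2 ⊢
      by_cases hz : z = o
      · subst hz; simp [hox]
      · tauto
    have hxyB : (x ∪ y) ∩ insert o B = y := by
      ext z
      have h1 := @hxs z
      have h2 := @hys z
      have h3 : z ∈ A → z ∉ B := fun h => Finset.disjoint_left.1 hAB h
      simp only [Finset.mem_inter, Finset.mem_union, Finset.mem_insert] at h1 h2 ⊢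
      by_cases hz : z = o
      · subst hz; simp [hoy]
      · tauto
    have hoxy : o ∈ x ∪ y := by simp [hox]
    let φ : List (Finset α) × List (Finset α) → List (Finset α) :=
      fun p => p.1.reverse ++ (x ∪ y) :: p.2
    let F := (MM a1 b1).toFinset ×ˢ (MM a2 b2).toFinset
    have hF : ∀ p ∈ F, Blk (A ∪ B) p.1 ∧ Blk (A ∪ B) p.2 ∧
        tr (insert o A) (φ p) = a1.reverse ++ x :: a2 ∧
        tr (insert o B) (φ p) = b1.reverse ++ y :: b2 := by
      rintro ⟨c1, c2⟩ hp
      simp only [F, Finset.mem_product, List.mem_toFinset] at hp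
      obtain ⟨i1, i2, i3⟩ := of_mem_MM A B hAB a1 b1 c1 ha1 hb1 hp.1
      obtain ⟨j1, j2, j3⟩ := of_mem_MM A B hAB a2 b2 c2 ha2 hb2 hp.2
      refine ⟨i1, j1, ?_, ?_⟩
      · rw [tr_mid i1 j1 hoZ hoxy, hxyA, i2, j2]
      · rw [tr_mid i1 j1 hoZ hoxy, hxyB, i3, j3]
    have hprop : ∀ p ∈ F, IsProperSeq X (φ p) := by
      intro p hp
      obtain ⟨h1, h2, h3, h4⟩ := hF p hp
      rw [hXAB]
      apply proper_of_tr
      · rw [← hXAB, hX]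
        intro K hK
        simp only [φ, List.mem_append, List.mem_reverse, List.mem_cons] at hK
        rcases hK with hK | rfl | hK
        · exact h1.mono (Finset.subset_insert _ _) K hK
        · refine ⟨Finset.ne_empty_of_mem hoxy, ?_⟩
          rw [← hX, hXAB]; exact Finset.union_subset_union hxs hys
        · exact h2.mono (Finset.subset_insert _ _) K hK
      · rw [h3]; exact hpa
      · rw [h4]; exact hpb
    have hinj : Set.InjOn φ F := by
      rintro ⟨c1, c2⟩ hp ⟨d1, d2⟩ hq h
      have h1 := hF _ hp
      have h2 := hF _ hq
      obtain ⟨e1, _, e2⟩ := split_unique o _ _ _ _ _ _ hoxy hoxy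
        (fun K hK => blk_notMem h1.1 hoZ K (by simpa using hK))
        (fun K hK => blk_notMem h2.1 hoZ K (by simpa using hK)) h
      exact Prod.ext (List.reverse_injective e1) e2
    have step : ∑ c ∈ (US X (opp X S)).support.filter
        (fun c => tr (insert o A) c = a1.reverse ++ x :: a2 ∧
          tr (insert o B) c = b1.reverse ++ y :: b2), US X (opp X S) c
        = ∑ c ∈ F.image φ, US X (opp X S) c := by
      apply Finset.sum_subset
      · intro c hc
        simp only [Finset.mem_filter, Finsupp.mem_support_iff] at hc
        obtain ⟨hc0, hcA, hcB⟩ := hc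
        have hpc := hsupp c hc0
        rw [hX] at hpc
        obtain ⟨c1, J, c2, rfl, hoJ, hc1, hc2, hJs⟩ := decomp hpc
        obtain ⟨i1, i2, i3⟩ := tr_mid_eq hc1 hc2 hoZ hoJ hoA hox ha1 hcA
        obtain ⟨j1, j2, j3⟩ := tr_mid_eq hc1 hc2 hoZ hoJ hoB hoy hb1 hcB
        rw [Finset.mem_image]
        refine ⟨(c1, c2), ?_, ?_⟩
        · simp only [F, Finset.mem_product, List.mem_toFinset]
          constructor
          · rw [← i1, ← j1]; exact mem_MM_of A B c1 hc1
          · rw [← i3, ← j3]; exact mem_MM_of A B c2 hc2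
        · have : J = x ∪ y := by
            rw [← i2, ← j2, ← Finset.inter_union_distrib_left, ← hXAB, hX,
              Finset.inter_eq_left.2 hJs]
          simp only [φ, this]
      · intro c hc hn
        by_contra h
        apply hn
        obtain ⟨p, hp, rfl⟩ := Finset.mem_image.1 hc
        obtain ⟨_, _, h3, h4⟩ := hF p hp
        simp only [Finset.mem_filter, Finsupp.mem_support_iff]
        exact ⟨h, h3, h4⟩
    have hval : ∀ p ∈ F, US X (opp X S) (φ p) = wt (opp X S) p.1 * wt S p.2 := by
      intro p hp
      apply US_eq_wt X (opp X S) S (opp X S) o p.1 p.2 (x ∪ y) (hprop p hp) hoxy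
      · intro K _ _; rfl
      · intro K hK _
        exact ⟨fun h => h.2, fun h => ⟨hK.1, h⟩⟩
    rw [step, Finset.sum_image hinj, Finset.sum_congr rfl hval, Finset.sum_product]
    simp only
    rw [← Finset.sum_mul_sum, sum_wt' A B hAB _ hmO a1 b1 ha1 hb1,
      sum_wt' A B hAB _ hmS a2 b2 ha2 hb2,
      US_eq_wt (insert o A) _ S (opp X S) o a1 a2 x hpa hox
        (rest_h1 A o S (opp X S)) (rest_h2 A o hoA S (opp X S)),
      US_eq_wt (insert o B) _ S (opp X S) o b1 b2 y hpb hoy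
        (rest_h1 B o S (opp X S)) (rest_h2 B o hoB S (opp X S))]
    ring
  · have hr : US (insert o A) (restCell A o (opp X S) S) a *
        US (insert o B) (restCell B o (opp X S) S) b = 0 := by
      rw [US_apply, US_apply]
      by_cases h1 : IsProperSeq (insert o A) a
      · have h2 : ¬ IsProperSeq (insert o B) b := fun h => hp ⟨h1, h⟩
        rw [if_neg (fun h : IsChainFor (insert o B) _ b => h2 h.1), mul_zero]
      · rw [if_neg (fun h : IsChainFor (insert o A) _ a => h1 h.1), zero_mul]
    rw [hr]
    apply Finset.sum_eq_zero
    intro c hc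
    simp only [Finset.mem_filter, Finsupp.mem_support_iff] at hc
    obtain ⟨hc0, rfl, rfl⟩ := hc
    have hpc := hsupp c hc0
    exact absurd ⟨proper_tr hpc (by rw [hXAB]; exact Finset.subset_union_left) (by simp),
      proper_tr hpc (by rw [hXAB]; exact Finset.subset_union_right) (by simp)⟩ hp

end GRF
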